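/- arXiv:1008.4707 — 2 statements merged into one kernel-verified Lean document; each statement's English description precedes it below -/
import Mathlib

section
/- For every ε > 0 there exists N such that for every n ≥ N and every orgraph Γ on n vertices the following approximate identity holds: | (4/9 − d₃) − ( (1/2)·((2/9 − t) − (2/3 − ρ) − p) − 3·(1/n)·Σ_v (1/3 − d⁺(v)/(n−1))² ) | ≤ ε, where d₃ is the edge density of FDF(Γ), ρ is the edge density and t the triangle density of the underlying graph of Γ, p is the density of induced P̄₃ in the underlying graph, and d⁺(v) is the out-degree of vertex v in Γ. -/
open Finset

/-- `E` is an orgraph relation: no loops and no pair of opposite edges. -/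
def IsOrgraph {V : Type*} (E : V → V → Prop) : Prop :=
  (∀ v, ¬ E v v) ∧ ∀ v w, E v w → ¬ E w v

/-- `E` contains an induced (oriented) 4-cycle: four distinct vertices whose
induced sub-orgraph has edge set exactly the oriented cycle. -/
def HasInducedC4 {V : Type*} (E : V → V → Prop) : Prop :=
  ∃ v₁ v₂ v₃ v₄ : V,
    v₁ ≠ v₂ ∧ v₁ ≠ v₃ ∧ v₁ ≠ v₄ ∧ v₂ ≠ v₃ ∧ v₂ ≠ v₄ ∧ v₃ ≠ v₄ ∧
    E v₁ v₂ ∧ E v₂ v₃ ∧ E v₃ v₄ ∧ E v₄ v₁ ∧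
    ¬ E v₂ v₁ ∧ ¬ E v₃ v₂ ∧ ¬ E v₄ v₃ ∧ ¬ E v₁ v₄ ∧
    ¬ E v₁ v₃ ∧ ¬ E v₃ v₁ ∧ ¬ E v₂ v₄ ∧ ¬ E v₄ v₂

/-- The triple `{u,v,w}` spans an edge of `FDF(Γ)`: within the triple, some
vertex has out-degree 2, or some vertex has in-degree 0 and out-degree 0. -/
def FDFedge {V : Type*} (E : V → V → Prop) (u v w : V) : Prop :=
  (E u v ∧ E u w) ∨ (E v u ∧ E v w) ∨ (E w u ∧ E w v) ∨
  (¬ E u v ∧ ¬ E v u ∧ ¬ E u w ∧ ¬ E w u) ∨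
  (¬ E v u ∧ ¬ E u v ∧ ¬ E v w ∧ ¬ E w v) ∨
  (¬ E w u ∧ ¬ E u w ∧ ¬ E w v ∧ ¬ E v w)

-- The number of edges of the 3-graph `FDF(Γ)`. 
open Classical in
noncomputable def fdfCount (V : Type*) [Fintype V] (E : V → V → Prop) : ℕ :=
  ((Finset.univ.powersetCard 3).filter (fun s : Finset V =>
    ∃ u v w : V, u ≠ v ∧ u ≠ w ∧ v ≠ w ∧ s = {u, v, w} ∧ FDFedge E u v w)).card

-- The number of edges of the undirected graph underlying the orgraph `E`. 
open Classical in
noncomputable def underlyingEdgeCount (V : Type*) [Fintype V] (E : V → V → Prop) : ℕ :=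
  ((Finset.univ.powersetCard 2).filter (fun s : Finset V =>
    ∃ u v : V, u ≠ v ∧ s = {u, v} ∧ (E u v ∨ E v u))).card

-- The number of triangles in the underlying graph of the orgraph E. 
open Classical in
noncomputable def triangleCount (V : Type*) [Fintype V] (E : V → V → Prop) : ℕ :=
  ((Finset.univ.powersetCard 3).filter (fun s : Finset V =>
    ∃ u v w : V, u ≠ v ∧ u ≠ w ∧ v ≠ w ∧ s = {u, v, w} ∧
      (E u v ∨ E v u) ∧ (E u w ∨ E w u) ∧ (E v w ∨ E w v))).card

-- The number of induced copies of P̄₃ (3-sets spanning exactly one edge) in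
--the underlying graph of the orgraph E. 
open Classical in
noncomputable def p3barCount (V : Type*) [Fintype V] (E : V → V → Prop) : ℕ :=
  ((Finset.univ.powersetCard 3).filter (fun s : Finset V =>
    ∃ u v w : V, u ≠ v ∧ u ≠ w ∧ v ≠ w ∧ s = {u, v, w} ∧
      (E u v ∨ E v u) ∧ ¬ (E u w ∨ E w u) ∧ ¬ (E v w ∨ E w v))).card

-- The out-degree of a vertex in the orgraph E. 
open Classical in
noncomputable def outDeg {V : Type*} [Fintype V] (E : V → V → Prop) (v : V) : ℕ :=
  (Finset.univ.filter (fun w : V => E v w)).card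


section Aux
open Classical

lemma aux_fiber {V : Type*} [Fintype V] (s : Finset V) (hs : s.card = 3) :
    ((Finset.univ : Finset (V × V × V)).filter (fun t => t.1 ≠ t.2.1 ∧ t.1 ≠ t.2.2 ∧ t.2.1 ≠ t.2.2 ∧
      ({t.1, t.2.1, t.2.2} : Finset V) = s)).card = 6 := by
  obtain ⟨a, b, c, hab, hac, hbc, rfl⟩ := Finset.card_eq_three.mp hs
  have : ((Finset.univ : Finset (V × V × V)).filter (fun t => t.1 ≠ t.2.1 ∧ t.1 ≠ t.2.2 ∧
      t.2.1 ≠ t.2.2 ∧ ({t.1, t.2.1, t.2.2} : Finset V) = {a, b, c}))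
      = {(a, b, c), (a, c, b), (b, a, c), (b, c, a), (c, a, b), (c, b, a)} := by
    ext ⟨u, v, w⟩
    simp only [mem_filter, mem_univ, true_and, mem_insert, mem_singleton, Prod.mk.injEq]
    constructor
    · rintro ⟨h1, h2, h3, h⟩
      have hu : u ∈ ({a, b, c} : Finset V) := by rw [← h]; simp
      have hv : v ∈ ({a, b, c} : Finset V) := by rw [← h]; simp
      have hw : w ∈ ({a, b, c} : Finset V) := by rw [← h]; simp
      simp only [mem_insert, mem_singleton] at hu hv hw
      grind
    · rintro (h | h | h | h | h | h) <;> obtain ⟨rfl, rfl, rfl⟩ := h <;>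
        refine ⟨by grind, by grind, by grind, ?_⟩ <;> ext x <;>
        simp only [mem_insert, mem_singleton] <;> tauto
  rw [this]
  have h1 := hab.symm
  have h2 := hac.symm
  have h3 := hbc.symm
  simp [*]

/-- real indicator -/
noncomputable def auxI (p : Prop) : ℝ := if p then 1 else 0

lemma aux_six {V : Type*} [Fintype V] (Q R : V → V → V → Prop)
    (K : Finset V → Prop) [DecidablePred K]
    (hK : ∀ s, K s ↔ ∃ u v w : V, u ≠ v ∧ u ≠ w ∧ v ≠ w ∧ s = {u, v, w} ∧ Q u v w)
    (h : ∀ u v w, u ≠ v → u ≠ w → v ≠ w →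
      (R u v w ↔ (Q u v w ∨ Q u w v ∨ Q v u w ∨ Q v w u ∨ Q w u v ∨ Q w v u))) :
    6 * (((Finset.univ.powersetCard 3).filter K).card : ℝ) =
    ∑ u, ∑ v, ∑ w, auxI (u ≠ v ∧ u ≠ w ∧ v ≠ w) * auxI (R u v w) := by
  set S := ((Finset.univ.powersetCard 3).filter K) with hS
  set A := (Finset.univ : Finset (V × V × V)).filter (fun t => (t.1 ≠ t.2.1 ∧ t.1 ≠ t.2.2 ∧
      t.2.1 ≠ t.2.2) ∧ R t.1 t.2.1 t.2.2) with hA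
  have key : ∀ u v w, u ≠ v → u ≠ w → v ≠ w → (({u, v, w} : Finset V) ∈ S ↔ R u v w) := by
    intro u v w h1 h2 h3
    rw [h u v w h1 h2 h3, hS, mem_filter, hK]
    constructor
    · rintro ⟨-, a, b, c, hab, hac, hbc, he, hq⟩
      have hu : a ∈ ({u, v, w} : Finset V) := by rw [he]; simp
      have hv : b ∈ ({u, v, w} : Finset V) := by rw [he]; simp
      have hw : c ∈ ({u, v, w} : Finset V) := by rw [he]; simp
      simp only [mem_insert, mem_singleton] at hu hv hw
      rcases hu with rfl | rfl | rfl <;> rcases hv with rfl | rfl | rfl <;>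
        rcases hw with rfl | rfl | rfl <;> tauto
    · intro hq
      refine ⟨?_, ?_⟩
      · rw [mem_powersetCard]
        exact ⟨subset_univ _, Finset.card_eq_three.mpr ⟨u, v, w, h1, h2, h3, rfl⟩⟩
      · rcases hq with hq | hq | hq | hq | hq | hq
        · exact ⟨u, v, w, h1, h2, h3, rfl, hq⟩
        · exact ⟨u, w, v, h2, h1, h3.symm, by ext x; simp only [mem_insert, mem_singleton]; tauto, hq⟩
        · exact ⟨v, u, w, h1.symm, h3, h2, by ext x; simp only [mem_insert, mem_singleton]; tauto, hq⟩
        · exact ⟨v, w, u, h3, h1.symm, h2.symm, by ext x; simp only [mem_insert, mem_singleton]; tauto, hq⟩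
        · exact ⟨w, u, v, h2.symm, h3.symm, h1, by ext x; simp only [mem_insert, mem_singleton]; tauto, hq⟩
        · exact ⟨w, v, u, h3.symm, h2.symm, h1.symm, by ext x; simp only [mem_insert, mem_singleton]; tauto, hq⟩
  have hcard : A.card = ∑ s ∈ S, 6 := by
    rw [Finset.card_eq_sum_card_fiberwise (f := fun t : V × V × V => ({t.1, t.2.1, t.2.2} : Finset V))
      (t := S)]
    · refine Finset.sum_congr rfl fun s hs => ?_
      have hs3 : s.card = 3 := by
        rw [hS, mem_filter, mem_powersetCard] at hs
        exact hs.1.2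
      rw [← aux_fiber s hs3]
      congr 1
      ext ⟨u, v, w⟩
      simp only [hA, mem_filter, mem_univ, true_and]
      constructor
      · rintro ⟨⟨⟨a, b, c⟩, -⟩, e⟩
        exact ⟨a, b, c, e⟩
      · rintro ⟨a, b, c, e⟩
        refine ⟨⟨⟨a, b, c⟩, ?_⟩, e⟩
        rw [← key u v w a b c, e]
        exact hs
    · rintro ⟨u, v, w⟩ ht
      simp only [hA, coe_filter, mem_univ, true_and, Set.mem_ofPred_eq] at ht
      obtain ⟨⟨a, b, c⟩, hr⟩ := ht
      exact (key u v w a b c).mpr hr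
  have h2 : (A.card : ℝ) = ∑ u, ∑ v, ∑ w, auxI (u ≠ v ∧ u ≠ w ∧ v ≠ w) * auxI (R u v w) := by
    rw [hA, Finset.card_filter]
    push_cast
    rw [Fintype.sum_prod_type]
    refine Finset.sum_congr rfl fun u _ => ?_
    rw [Fintype.sum_prod_type]
    refine Finset.sum_congr rfl fun v _ => Finset.sum_congr rfl fun w _ => ?_
    simp only [auxI]
    split_ifs <;> simp_all
  rw [← h2, hcard]
  simp
  ring

lemma aux_deg {V : Type*} [Fintype V] (E : V → V → Prop) (u : V) :
    (outDeg E u : ℝ) = ∑ v, auxI (E u v) := by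
  simp [outDeg, auxI]

lemma aux_edge {V : Type*} [Fintype V] (E : V → V → Prop) (hE : IsOrgraph E) :
    (underlyingEdgeCount V E : ℝ) = ∑ v, (outDeg E v : ℝ) := by
  have h1 : underlyingEdgeCount V E =
      ((Finset.univ : Finset (V × V)).filter (fun t => E t.1 t.2)).card := by
    unfold underlyingEdgeCount
    symm
    refine Finset.card_bij (fun t _ => ({t.1, t.2} : Finset V)) ?_ ?_ ?_
    · rintro ⟨u, v⟩ h
      simp only [mem_filter, mem_univ, true_and] at h
      have huv : u ≠ v := by rintro rfl; exact hE.1 _ h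
      simp only [mem_filter, mem_powersetCard, subset_univ, true_and]
      exact ⟨Finset.card_pair huv, u, v, huv, rfl, Or.inl h⟩
    · rintro ⟨u, v⟩ h ⟨a, b⟩ h' e
      simp only [mem_filter, mem_univ, true_and] at h h'
      have hu : u ∈ ({a, b} : Finset V) := by rw [← e]; simp
      have hv : v ∈ ({a, b} : Finset V) := by rw [← e]; simp
      simp only [mem_insert, mem_singleton] at hu hv
      have := hE.1
      have := hE.2
      rcases hu with rfl | rfl <;> rcases hv with rfl | rfl <;> simp_all
    · intro s hs
      simp only [mem_filter] at hs
      obtain ⟨-, u, v, huv, rfl, h | h⟩ := hs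
      · exact ⟨(u, v), by simpa using h, rfl⟩
      · exact ⟨(v, u), by simpa using h, Finset.pair_comm _ _⟩
  rw [h1, Finset.card_filter]
  push_cast
  rw [Fintype.sum_prod_type]
  refine Finset.sum_congr rfl fun u _ => ?_
  rw [aux_deg]
  rfl

lemma aux_point {V : Type*} (E : V → V → Prop) (hE : IsOrgraph E) (u v w : V) :
    2 * auxI (FDFedge E u v w) =
      2 * (auxI (E u v) * auxI (E u w) + auxI (E v u) * auxI (E v w) + auxI (E w u) * auxI (E w v))
      + 2 + auxI ((E u v ∨ E v u) ∧ (E u w ∨ E w u) ∧ (E v w ∨ E w v))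
      + auxI (((E u v ∨ E v u) ∧ ¬ (E u w ∨ E w u) ∧ ¬ (E v w ∨ E w v)) ∨
          ((E u w ∨ E w u) ∧ ¬ (E u v ∨ E v u) ∧ ¬ (E v w ∨ E w v)) ∨
          ((E v w ∨ E w v) ∧ ¬ (E u v ∨ E v u) ∧ ¬ (E u w ∨ E w u)))
      - (auxI (E u v) + auxI (E v u) + auxI (E u w) + auxI (E w u) + auxI (E v w) + auxI (E w v)) := by
  have tri : ∀ p q : V, (E p q ∧ ¬ E q p) ∨ (¬ E p q ∧ E q p) ∨ (¬ E p q ∧ ¬ E q p) := by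
    intro p q
    have := hE.2 p q
    tauto
  unfold FDFedge auxI
  rcases tri u v with ⟨a, a'⟩ | ⟨a, a'⟩ | ⟨a, a'⟩ <;>
    rcases tri u w with ⟨b, b'⟩ | ⟨b, b'⟩ | ⟨b, b'⟩ <;>
    rcases tri v w with ⟨c, c'⟩ | ⟨c, c'⟩ | ⟨c, c'⟩ <;> simp [a, a', b, b', c, c'] <;> norm_num

set_option maxHeartbeats 1000000 in
lemma aux_main {V : Type*} [Fintype V] (E : V → V → Prop) (hE : IsOrgraph E) :
    12 * (fdfCount V E : ℝ) =
      6 * (∑ v, (outDeg E v : ℝ) ^ 2 - ∑ v, (outDeg E v : ℝ)) + 2 * ((Fintype.card V : ℝ) * (Fintype.card V - 1) * ((Fintype.card V : ℝ) - 2))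
      + 6 * (p3barCount V E : ℝ) + 6 * (triangleCount V E : ℝ)
      - 6 * (∑ v, (outDeg E v : ℝ)) * ((Fintype.card V : ℝ) - 2) := by
  let T : (V → V → V → ℝ) → ℝ := fun f => ∑ u, ∑ v, ∑ w, f u v w
  let D : V → V → V → ℝ := fun u v w => auxI (u ≠ v ∧ u ≠ w ∧ v ≠ w)
  let x : V → V → ℝ := fun u v => auxI (E u v)
  have hF : 6 * (fdfCount V E : ℝ) = T fun u v w => D u v w * auxI (FDFedge E u v w) := by
    refine aux_six (FDFedge E) (FDFedge E) _ (fun _ => Iff.rfl) ?_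
    intro u v w _ _ _
    constructor
    · exact Or.inl
    · have g1 : ∀ p q r, FDFedge E p q r → FDFedge E q p r := by
        rintro p q r (h | h | h | h | h | h) <;> unfold FDFedge <;> simp [h.1, h.2]
      have g2 : ∀ p q r, FDFedge E p q r → FDFedge E p r q := by
        rintro p q r (h | h | h | h | h | h) <;> unfold FDFedge <;> simp [h.1, h.2]
      rintro (h | h | h | h | h | h)
      · exact h
      · exact g2 _ _ _ h
      · exact g1 _ _ _ h
      · exact g1 _ _ _ (g2 _ _ _ h)
      · exact g2 _ _ _ (g1 _ _ _ h)
      · exact g1 _ _ _ (g2 _ _ _ (g1 _ _ _ h))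
  have hT : 6 * (triangleCount V E : ℝ) = T fun u v w => D u v w *
      auxI ((E u v ∨ E v u) ∧ (E u w ∨ E w u) ∧ (E v w ∨ E w v)) := by
    refine aux_six
      (fun u v w => (E u v ∨ E v u) ∧ (E u w ∨ E w u) ∧ (E v w ∨ E w v))
      (fun u v w => (E u v ∨ E v u) ∧ (E u w ∨ E w u) ∧ (E v w ∨ E w v)) _ (fun _ => Iff.rfl) ?_
    intro u v w _ _ _
    simp only [show (E v u ∨ E u v) = (E u v ∨ E v u) from propext or_comm,
      show (E w u ∨ E u w) = (E u w ∨ E w u) from propext or_comm,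
      show (E w v ∨ E v w) = (E v w ∨ E w v) from propext or_comm]
    generalize (E u v ∨ E v u) = a
    generalize (E u w ∨ E w u) = b
    generalize (E v w ∨ E w v) = c
    by_cases a <;> by_cases b <;> by_cases c <;> simp [*]
  have hP : 6 * (p3barCount V E : ℝ) = T fun u v w => D u v w *
      auxI (((E u v ∨ E v u) ∧ ¬ (E u w ∨ E w u) ∧ ¬ (E v w ∨ E w v)) ∨
          ((E u w ∨ E w u) ∧ ¬ (E u v ∨ E v u) ∧ ¬ (E v w ∨ E w v)) ∨
          ((E v w ∨ E w v) ∧ ¬ (E u v ∨ E v u) ∧ ¬ (E u w ∨ E w u))) := by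
    refine aux_six
      (fun u v w => (E u v ∨ E v u) ∧ ¬ (E u w ∨ E w u) ∧ ¬ (E v w ∨ E w v))
      (fun u v w => ((E u v ∨ E v u) ∧ ¬ (E u w ∨ E w u) ∧ ¬ (E v w ∨ E w v)) ∨
          ((E u w ∨ E w u) ∧ ¬ (E u v ∨ E v u) ∧ ¬ (E v w ∨ E w v)) ∨
          ((E v w ∨ E w v) ∧ ¬ (E u v ∨ E v u) ∧ ¬ (E u w ∨ E w u))) _ (fun _ => Iff.rfl) ?_
    intro u v w _ _ _
    simp only [show (E v u ∨ E u v) = (E u v ∨ E v u) from propext or_comm,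
      show (E w u ∨ E u w) = (E u w ∨ E w u) from propext or_comm,
      show (E w v ∨ E v w) = (E v w ∨ E w v) from propext or_comm]
    generalize (E u v ∨ E v u) = a
    generalize (E u w ∨ E w u) = b
    generalize (E v w ∨ E w v) = c
    by_cases a <;> by_cases b <;> by_cases c <;> simp [*]
  have s12 : ∀ f, T f = T fun u v w => f v u w := fun f => Finset.sum_comm
  have s23 : ∀ f, T f = T fun u v w => f u w v := fun f =>
    Finset.sum_congr rfl fun u _ => Finset.sum_comm
  have D12 : ∀ u v w, D v u w = D u v w := by
    intro u v w; simp only [D]; congr 1; apply propext; constructor <;> rintro ⟨a, b, c⟩ <;>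
      exact ⟨a.symm, c, b⟩
  have D23 : ∀ u v w, D u w v = D u v w := by
    intro u v w; simp only [D]; congr 1; apply propext; constructor <;> rintro ⟨a, b, c⟩ <;>
      exact ⟨b, a, c.symm⟩
  have hx : ∀ u, x u u = 0 := fun u => by simp [x, auxI, hE.1 u]
  have hd : ∀ u, ∑ v, x u v = (outDeg E u : ℝ) := fun u => (aux_deg E u).symm
  -- cherries
  have c1 : T (fun u v w => D u v w * (x u v * x u w)) =
      ∑ v, (outDeg E v : ℝ) ^ 2 - ∑ v, (outDeg E v : ℝ) := by
    have : ∀ u v w, D u v w * (x u v * x u w) = x u v * x u w - (if v = w then x u v else 0) := by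
      intro u v w
      by_cases h1 : u = v
      · subst h1; simp [hx]
      by_cases h2 : u = w
      · subst h2; simp [hx, Ne.symm h1]
      by_cases h3 : v = w
      · subst h3; by_cases h4 : E u v <;> simp [D, x, auxI, h4]
      · simp [D, auxI, h1, h2, h3]
    simp only [T, this, Finset.sum_sub_distrib, ← Finset.mul_sum, ← Finset.sum_mul, hd,
      Finset.sum_ite_eq, mem_univ, if_true, sq]
  have c2 : T (fun u v w => D u v w * (x v u * x v w)) =
      ∑ v, (outDeg E v : ℝ) ^ 2 - ∑ v, (outDeg E v : ℝ) := by
    rw [s12, ← c1]; simp only [D12]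
  have c3 : T (fun u v w => D u v w * (x w u * x w v)) =
      ∑ v, (outDeg E v : ℝ) ^ 2 - ∑ v, (outDeg E v : ℝ) := by
    rw [s23, ← c2]; simp only [D23]
  -- edges
  have e1 : T (fun u v w => D u v w * x u v) = (∑ v, (outDeg E v : ℝ)) * ((Fintype.card V : ℝ) - 2) := by
    have : ∀ u v w, D u v w * x u v = x u v - (if u = w then x u v else 0)
        - (if v = w then x u v else 0) := by
      intro u v w
      by_cases h1 : u = v
      · subst h1; simp [hx]
      by_cases h2 : u = w
      · subst h2; simp [D, auxI, Ne.symm h1]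
      by_cases h3 : v = w
      · subst h3; simp [D, auxI, h1]
      · simp [D, auxI, h1, h2, h3]
    simp only [T, this, Finset.sum_sub_distrib, ← Finset.mul_sum, ← Finset.sum_mul, hd,
      Finset.sum_ite_eq, mem_univ, if_true, Finset.sum_const, Finset.card_univ,
      nsmul_eq_mul]
    ring
  have e2 : T (fun u v w => D u v w * x v u) = (∑ v, (outDeg E v : ℝ)) * ((Fintype.card V : ℝ) - 2) := by
    rw [s12, ← e1]; simp only [D12]
  have e3 : T (fun u v w => D u v w * x u w) = (∑ v, (outDeg E v : ℝ)) * ((Fintype.card V : ℝ) - 2) := by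
    rw [s23, ← e1]; simp only [D23]
  have e4 : T (fun u v w => D u v w * x w u) = (∑ v, (outDeg E v : ℝ)) * ((Fintype.card V : ℝ) - 2) := by
    rw [s23, ← e2]; simp only [D23]
  have e5 : T (fun u v w => D u v w * x v w) = (∑ v, (outDeg E v : ℝ)) * ((Fintype.card V : ℝ) - 2) := by
    rw [s12, ← e3]; simp only [D12]
  have e6 : T (fun u v w => D u v w * x w v) = (∑ v, (outDeg E v : ℝ)) * ((Fintype.card V : ℝ) - 2) := by
    rw [s23, ← e5]; simp only [D23]
  have t1 : T (fun u v w => D u v w) = (Fintype.card V : ℝ) * ((Fintype.card V : ℝ) - 1) * ((Fintype.card V : ℝ) - 2) := by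
    have : ∀ u v w, D u v w = 1 - (if u = v then 1 else 0) - (if u = w then 1 else 0)
        - (if v = w then 1 else 0) + (if u = v then (if u = w then 2 else 0) else 0) := by
      intro u v w
      by_cases h1 : u = v
      · subst h1
        by_cases h2 : u = w
        · subst h2; simp [D, auxI]; norm_num
        · simp [D, auxI, h2]
      by_cases h2 : u = w
      · subst h2; simp [D, auxI, h1, Ne.symm h1]
      by_cases h3 : v = w
      · subst h3; simp [D, auxI, h1]
      · simp [D, auxI, h1, h2, h3]
    have h5 : ∀ u v : V, ∑ w, (if u = v then (if u = w then (2:ℝ) else 0) else 0) =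
        if u = v then 2 else 0 := by
      intro u v; split_ifs <;> simp
    simp only [T, this, Finset.sum_sub_distrib, Finset.sum_add_distrib, h5,
      Finset.sum_ite_eq, mem_univ, if_true, Finset.sum_const, Finset.card_univ,
      nsmul_eq_mul]
    simp
    ring
  have hsum : 2 * (T fun u v w => D u v w * auxI (FDFedge E u v w)) =
      2 * (T (fun u v w => D u v w * (x u v * x u w)) + T (fun u v w => D u v w * (x v u * x v w))
        + T (fun u v w => D u v w * (x w u * x w v))) + 2 * T (fun u v w => D u v w)
      + (T fun u v w => D u v w *
      auxI ((E u v ∨ E v u) ∧ (E u w ∨ E w u) ∧ (E v w ∨ E w v)))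
      + (T fun u v w => D u v w *
      auxI (((E u v ∨ E v u) ∧ ¬ (E u w ∨ E w u) ∧ ¬ (E v w ∨ E w v)) ∨
          ((E u w ∨ E w u) ∧ ¬ (E u v ∨ E v u) ∧ ¬ (E v w ∨ E w v)) ∨
          ((E v w ∨ E w v) ∧ ¬ (E u v ∨ E v u) ∧ ¬ (E u w ∨ E w u))))
      - (T (fun u v w => D u v w * x u v) + T (fun u v w => D u v w * x v u)
        + T (fun u v w => D u v w * x u w) + T (fun u v w => D u v w * x w u)
        + T (fun u v w => D u v w * x v w) + T (fun u v w => D u v w * x w v)) := by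
    simp only [T, Finset.mul_sum, ← Finset.sum_add_distrib, ← Finset.sum_sub_distrib]
    refine Finset.sum_congr rfl fun u _ => Finset.sum_congr rfl fun v _ =>
      Finset.sum_congr rfl fun w _ => ?_
    have := aux_point E hE u v w
    simp only [x]
    linear_combination (D u v w) * this
  rw [← hF, ← hT, ← hP, c1, c2, c3, e1, e2, e3, e4, e5, e6, t1] at hsum
  linear_combination hsum

lemma aux_degle {V : Type*} [Fintype V] (E : V → V → Prop) (hE : IsOrgraph E) (v : V) :
    (outDeg E v : ℝ) ≤ (Fintype.card V : ℝ) - 1 := by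
  have : outDeg E v + 1 ≤ Fintype.card V := by
    have h : (Finset.univ.filter (fun w => E v w)) ⊂ (Finset.univ : Finset V) := by
      rw [Finset.filter_ssubset]
      exact ⟨v, mem_univ _, hE.1 v⟩
    have := Finset.card_lt_card h
    simp only [Finset.card_univ] at this
    exact this
  have h2 : ((outDeg E v : ℝ) + 1) ≤ (Fintype.card V : ℝ) := by exact_mod_cast this
  linarith

end Aux

/-- The approximate identity
4/9 − d₃ ≈ (1/2)·((2/9 − t) − (2/3 − ρ) − p) − 3·(1/n)·Σ_v (1/3 − d⁺(v)/(n−1))²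
holds up to ε for every orgraph on n ≥ N vertices. -/
theorem stmt11 :
    ∀ ε : ℝ, ε > 0 → ∃ N : ℕ, ∀ n : ℕ, N ≤ n → ∀ E : Fin n → Fin n → Prop,
      IsOrgraph E →
      |((4 : ℝ) / 9 - (fdfCount (Fin n) E : ℝ) / (n.choose 3 : ℝ)) -
        ((1 / 2) * (((2 : ℝ) / 9 - (triangleCount (Fin n) E : ℝ) / (n.choose 3 : ℝ))
              - ((2 : ℝ) / 3 - (underlyingEdgeCount (Fin n) E : ℝ) / (n.choose 2 : ℝ))
              - (p3barCount (Fin n) E : ℝ) / (n.choose 3 : ℝ))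
          - 3 * (1 / (n : ℝ)) *
              ∑ v : Fin n, ((1 : ℝ) / 3 - (outDeg E v : ℝ) / ((n : ℝ) - 1)) ^ 2)| ≤ ε := by
  intro ε hε
  obtain ⟨N, hN⟩ := exists_nat_gt (3 / ε)
  refine ⟨N + 3, fun n hn E hE => ?_⟩
  have hn1 : (N : ℝ) + 3 ≤ n := by exact_mod_cast hn
  have hN0 : (0 : ℝ) ≤ N := Nat.cast_nonneg N
  have hc2 : (n.choose 2 : ℝ) = n * (n - 1) / 2 := Nat.cast_choose_two ℝ n
  have hc3 : (n.choose 3 : ℝ) = n * (n - 1) * (n - 2) / 6 := by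
    obtain ⟨m, rfl⟩ : ∃ m, n = m + 3 := ⟨n - 3, by omega⟩
    rw [Nat.cast_choose_eq_ascPochhammer_div]
    simp [ascPochhammer_succ_eval, Nat.factorial]
    ring
  have hm := aux_main E hE
  rw [Fintype.card_fin] at hm
  have hdl := aux_degle E hE
  rw [Fintype.card_fin] at hdl
  have he := aux_edge E hE
  have hsq : ∑ v : Fin n, ((1 : ℝ) / 3 - (outDeg E v : ℝ) / ((n : ℝ) - 1)) ^ 2 =
      n / 9 - 2 / 3 * (∑ v, (outDeg E v : ℝ)) / (n - 1)
        + (∑ v, (outDeg E v : ℝ) ^ 2) / (n - 1) ^ 2 := by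
    have : ∀ v : Fin n, ((1 : ℝ) / 3 - (outDeg E v : ℝ) / ((n : ℝ) - 1)) ^ 2 =
      1 / 9 - 2 / 3 * (outDeg E v : ℝ) / (n - 1) + (outDeg E v : ℝ) ^ 2 / (n - 1) ^ 2 := by
      intro v
      rw [← div_pow]
      ring
    simp only [this, Finset.sum_add_distrib, Finset.sum_sub_distrib, ← Finset.sum_div,
      ← Finset.mul_sum, Finset.sum_const, card_univ, Fintype.card_fin, nsmul_eq_mul]
    ring
  have hM : ∑ v, (outDeg E v : ℝ) ≤ n * (n - 1) := by
    calc ∑ v, (outDeg E v : ℝ) ≤ ∑ v : Fin n, ((n : ℝ) - 1) :=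
          Finset.sum_le_sum fun v _ => hdl v
      _ = n * (n - 1) := by simp [-mul_eq_mul_left_iff]; try ring
  have hS0 : 0 ≤ ∑ v, (outDeg E v : ℝ) ^ 2 := Finset.sum_nonneg fun v _ => sq_nonneg _
  have hS : ∑ v, (outDeg E v : ℝ) ^ 2 ≤ (n - 1) * ∑ v, (outDeg E v : ℝ) := by
    rw [Finset.mul_sum]
    refine Finset.sum_le_sum fun v _ => ?_
    rw [sq]
    exact mul_le_mul_of_nonneg_right (hdl v) (Nat.cast_nonneg _)
  rw [hsq, he, hc2, hc3]
  generalize ∑ v, (outDeg E v : ℝ) ^ 2 = S at *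
  generalize ∑ v, (outDeg E v : ℝ) = M at *
  generalize (fdfCount (Fin n) E : ℝ) = F at *
  generalize (p3barCount (Fin n) E : ℝ) = P at *
  generalize (triangleCount (Fin n) E : ℝ) = T at *
  generalize (n : ℝ) = y at *
  have y0 : 0 < y := by linarith
  have y1 : 0 < y - 1 := by linarith
  have y2 : 0 < y - 2 := by linarith
  have hF : F = (6 * (S - M) + 2 * (y * (y - 1) * (y - 2)) + 6 * P + 6 * T - 6 * M * (y - 2)) / 12 := by
    linarith
  have hz : ((4 : ℝ) / 9 - F / (y * (y - 1) * (y - 2) / 6)) -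
        ((1 / 2) * (((2 : ℝ) / 9 - T / (y * (y - 1) * (y - 2) / 6))
              - ((2 : ℝ) / 3 - M / (y * (y - 1) / 2))
              - P / (y * (y - 1) * (y - 2) / 6))
          - 3 * (1 / y) * (y / 9 - 2 / 3 * M / (y - 1) + S / (y - 1) ^ 2)) =
      3 * ((y - 1) * M - S) / (y * (y - 1) ^ 2 * (y - 2)) := by
    rw [hF]
    field_simp
    ring
  rw [hz]
  have hden : 0 < y * (y - 1) ^ 2 * (y - 2) := by positivity
  have hnum : 0 ≤ (y - 1) * M - S := by linarith
  rw [abs_of_nonneg (by positivity), div_le_iff₀ hden]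
  have h3 : 3 ≤ ε * (y - 2) := by
    rw [div_lt_iff₀ hε] at hN
    nlinarith
  have h4 : (y - 1) * M ≤ y * (y - 1) ^ 2 := by nlinarith
  have h5 : 0 ≤ y * (y - 1) ^ 2 := by positivity
  nlinarith
end

section
/- For every ε > 0 there exists N such that for every n ≥ N there exists an orgraph Γ on n vertices with at most (7/16 + ε)·C(n,3) edges in FDF(Γ). Hence the lower bound 7/16 on the asymptotic edge density of FDF(Γ) over all orgraphs Γ (with no C⃗4-freeness assumption) is tight; such Γ can be taken to be an orientation of a complete balanced bipartite graph. -/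
open Finset

/-- The blow-up of the oriented 4-cycle on `Fin n`: residue classes mod 4. -/
def cycE (n : ℕ) (u v : Fin n) : Prop := u.val % 4 = (v.val + 1) % 4

/-- Residue class mod 4. -/
def cls (n : ℕ) (c : ℕ) : Finset (Fin n) := Finset.univ.filter (fun i => i.val % 4 = c)

/-- The odd vertices. -/
def oddSet (n : ℕ) : Finset (Fin n) := Finset.univ.filter (fun i => i.val % 2 = 1)

theorem card_cls_le (n c : ℕ) : (cls n c).card ≤ n / 4 + 1 := by
  have : (cls n c).card ≤ (Finset.range (n / 4 + 1)).card := by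
    apply Finset.card_le_card_of_injOn (fun i => i.val / 4)
    · intro i _
      have := i.isLt
      simp only [Finset.coe_range, Set.mem_Iio]
      omega
    · intro i hi j hj h
      simp only [cls, Finset.coe_filter, Finset.mem_univ, true_and, Set.mem_ofPred_eq] at hi hj h
      apply Fin.ext
      omega
  simpa using this

theorem card_oddSet (n : ℕ) : (oddSet n).card = n / 2 := by
  have h : oddSet n = Finset.univ.image
      (fun k : Fin (n / 2) => (⟨2 * k.val + 1, by have := k.isLt; omega⟩ : Fin n)) := by
    ext i
    have := i.isLt
    simp only [oddSet, Finset.mem_filter, Finset.mem_univ, true_and, Finset.mem_image]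
    constructor
    · intro hi
      refine ⟨⟨i.val / 2, by omega⟩, ?_⟩
      apply Fin.ext
      simp only
      omega
    · rintro ⟨k, rfl⟩
      simp only
      omega
  rw [h, Finset.card_image_of_injective, Finset.card_univ, Fintype.card_fin]
  intro a b hab
  simp only [Fin.mk.injEq] at hab
  apply Fin.ext
  omega

/-- The triples with one vertex in class `d` and a pair in class `c`. -/
def cherry (n c d : ℕ) : Finset (Finset (Fin n)) :=
  ((cls n d) ×ˢ (Finset.powersetCard 2 (cls n c))).image (fun p => insert p.1 p.2)

theorem card_cherry_le (n c d : ℕ) :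
    (cherry n c d).card ≤ (n / 4 + 1) * (n / 4 + 1).choose 2 := by
  refine Finset.card_image_le.trans ?_
  rw [Finset.card_product, Finset.card_powersetCard]
  exact Nat.mul_le_mul (card_cls_le n d) (Nat.choose_le_choose 2 (card_cls_le n c))

theorem mem_cherry {n : ℕ} {u v w : Fin n} (c d : ℕ) (hvw : v ≠ w) (hu : u.val % 4 = d)
    (hv : v.val % 4 = c) (hw : w.val % 4 = c) : ({u, v, w} : Finset (Fin n)) ∈ cherry n c d := by
  simp only [cherry, Finset.mem_image, Finset.mem_product, Finset.mem_powersetCard]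
  refine ⟨(u, {v, w}), ⟨by simp [cls, hu], ?_, Finset.card_pair hvw⟩, rfl⟩
  intro x hx
  simp only [Finset.mem_insert, Finset.mem_singleton] at hx
  rcases hx with rfl | rfl <;> simp [cls, *]

/-- A finite family containing all edges of the 3-graph. -/
def cover (n : ℕ) : Finset (Finset (Fin n)) :=
  (Finset.powersetCard 3 (oddSet n) ∪ Finset.powersetCard 3 (oddSet n)ᶜ) ∪
    ((cherry n 0 1 ∪ cherry n 1 2) ∪ (cherry n 2 3 ∪ cherry n 3 0))

theorem mem_cover_cherry {n : ℕ} {u v w : Fin n} (hvw : v ≠ w)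
    (h1 : cycE n u v) (h2 : cycE n u w) : ({u, v, w} : Finset (Fin n)) ∈ cover n := by
  unfold cycE at h1 h2
  have hc : v.val % 4 = 0 ∨ v.val % 4 = 1 ∨ v.val % 4 = 2 ∨ v.val % 4 = 3 := by omega
  simp only [cover, Finset.mem_union]
  rcases hc with h | h | h | h
  · exact Or.inr (Or.inl (Or.inl (mem_cherry 0 1 hvw (by omega) h (by omega))))
  · exact Or.inr (Or.inl (Or.inr (mem_cherry 1 2 hvw (by omega) h (by omega))))
  · exact Or.inr (Or.inr (Or.inl (mem_cherry 2 3 hvw (by omega) h (by omega))))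
  · exact Or.inr (Or.inr (Or.inr (mem_cherry 3 0 hvw (by omega) h (by omega))))

theorem mem_cover_iso {n : ℕ} {u v w : Fin n} (huv : u ≠ v) (huw : u ≠ w) (hvw : v ≠ w)
    (h1 : ¬ cycE n u v) (h2 : ¬ cycE n v u) (h3 : ¬ cycE n u w) (h4 : ¬ cycE n w u) :
    ({u, v, w} : Finset (Fin n)) ∈ cover n := by
  unfold cycE at h1 h2 h3 h4
  have hv : v.val % 2 = u.val % 2 := by omega
  have hw : w.val % 2 = u.val % 2 := by omega
  have hcard : ({u, v, w} : Finset (Fin n)).card = 3 := Finset.card_eq_three.2 ⟨u, v, w, huv, huw, hvw, rfl⟩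
  simp only [cover, Finset.mem_union, Finset.mem_powersetCard]
  rcases Nat.mod_two_eq_zero_or_one u.val with h | h
  · refine Or.inl (Or.inr ⟨?_, hcard⟩)
    intro x hx
    simp only [Finset.mem_insert, Finset.mem_singleton] at hx
    rcases hx with rfl | rfl | rfl <;> simp [oddSet] <;> omega
  · refine Or.inl (Or.inl ⟨?_, hcard⟩)
    intro x hx
    simp only [Finset.mem_insert, Finset.mem_singleton] at hx
    rcases hx with rfl | rfl | rfl <;> simp [oddSet] <;> omega

theorem fdfCount_le_cover (n : ℕ) : fdfCount (Fin n) (cycE n) ≤ (cover n).card := by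
  unfold fdfCount
  apply Finset.card_le_card
  intro s hs
  simp only [Finset.mem_filter] at hs
  obtain ⟨_, u, v, w, huv, huw, hvw, hs, h⟩ := hs
  have e0 : s = ({u, v, w} : Finset (Fin n)) := by rw [hs]; ext; simp
  rw [e0]
  have e1 : ({u, v, w} : Finset (Fin n)) = {v, u, w} := by ext; simp; tauto
  have e2 : ({u, v, w} : Finset (Fin n)) = {w, u, v} := by ext; simp; tauto
  rcases h with h | h | h | h | h | h
  · exact mem_cover_cherry hvw h.1 h.2
  · rw [e1]; exact mem_cover_cherry huw h.1 h.2
  · rw [e2]; exact mem_cover_cherry huv h.1 h.2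
  · exact mem_cover_iso huv huw hvw h.1 h.2.1 h.2.2.1 h.2.2.2
  · rw [e1]; exact mem_cover_iso huv.symm hvw huw h.1 h.2.1 h.2.2.1 h.2.2.2
  · rw [e2]; exact mem_cover_iso huw.symm hvw.symm huv h.1 h.2.1 h.2.2.1 h.2.2.2

theorem card_cover_le (n : ℕ) : (cover n).card ≤
    2 * (n / 2 + 1).choose 3 + 4 * ((n / 4 + 1) * (n / 4 + 1).choose 2) := by
  have hA : (Finset.powersetCard 3 (oddSet n)).card ≤ (n / 2 + 1).choose 3 := by
    rw [Finset.card_powersetCard, card_oddSet]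
    exact Nat.choose_le_choose 3 (by omega)
  have hB : (Finset.powersetCard 3 (oddSet n)ᶜ).card ≤ (n / 2 + 1).choose 3 := by
    rw [Finset.card_powersetCard, Finset.card_compl, card_oddSet, Fintype.card_fin]
    exact Nat.choose_le_choose 3 (by omega)
  have u1 := Finset.card_union_le (Finset.powersetCard 3 (oddSet n)) (Finset.powersetCard 3 (oddSet n)ᶜ)
  have u2 := Finset.card_union_le (cherry n 0 1) (cherry n 1 2)
  have u3 := Finset.card_union_le (cherry n 2 3) (cherry n 3 0)
  have u4 := Finset.card_union_le (cherry n 0 1 ∪ cherry n 1 2) (cherry n 2 3 ∪ cherry n 3 0)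
  have u5 := Finset.card_union_le
    (Finset.powersetCard 3 (oddSet n) ∪ Finset.powersetCard 3 (oddSet n)ᶜ)
    ((cherry n 0 1 ∪ cherry n 1 2) ∪ (cherry n 2 3 ∪ cherry n 3 0))
  have c1 := card_cherry_le n 0 1
  have c2 := card_cherry_le n 1 2
  have c3 := card_cherry_le n 2 3
  have c4 := card_cherry_le n 3 0
  unfold cover
  omega

theorem cover_real_bound (n : ℕ) : ((cover n).card : ℝ) ≤
    1 / 3 * ((n : ℝ) / 2 + 1) ^ 3 + 2 * ((n : ℝ) / 4 + 1) ^ 3 := by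
  have h : ((cover n).card : ℝ) ≤ 2 * ((n / 2 + 1).choose 3 : ℕ) +
      4 * (((n / 4 + 1 : ℕ) : ℝ) * ((n / 4 + 1).choose 2 : ℕ)) := by
    exact_mod_cast card_cover_le n
  have h3 := Nat.choose_le_pow_div (α := ℝ) 3 (n / 2 + 1)
  have h2 := Nat.choose_le_pow_div (α := ℝ) 2 (n / 4 + 1)
  have d2 : ((n / 2 + 1 : ℕ) : ℝ) ≤ (n : ℝ) / 2 + 1 := by
    push_cast
    have := Nat.cast_div_le (α := ℝ) (m := n) (n := 2)
    push_cast at this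
    linarith
  have d4 : ((n / 4 + 1 : ℕ) : ℝ) ≤ (n : ℝ) / 4 + 1 := by
    push_cast
    have := Nat.cast_div_le (α := ℝ) (m := n) (n := 4)
    push_cast at this
    linarith
  have hy : (0 : ℝ) ≤ ((n / 4 + 1 : ℕ) : ℝ) := Nat.cast_nonneg _
  have hx3 : (((n / 2 + 1 : ℕ) : ℝ)) ^ 3 ≤ ((n : ℝ) / 2 + 1) ^ 3 := by
    gcongr
  have hy3 : (((n / 4 + 1 : ℕ) : ℝ)) ^ 3 ≤ ((n : ℝ) / 4 + 1) ^ 3 := by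
    gcongr
  have h2' := mul_le_mul_of_nonneg_left h2 hy
  norm_num [Nat.factorial] at h3 h2' hx3 hy3 h ⊢
  nlinarith

theorem choose_three_real (n : ℕ) (hn : 3 ≤ n) :
    (n.choose 3 : ℝ) = (n : ℝ) * (n - 1) * (n - 2) / 6 := by
  obtain ⟨m, rfl⟩ := Nat.exists_eq_add_of_le hn
  have h := Nat.descFactorial_eq_factorial_mul_choose (3 + m) 3
  have e1 : 3 + m - 2 = m + 1 := by omega
  have e2 : 3 + m - 1 = m + 2 := by omega
  simp only [Nat.descFactorial, Nat.factorial, e1, e2] at h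
  have h' := congrArg (Nat.cast : ℕ → ℝ) h
  push_cast at h' ⊢
  norm_num at h'
  linarith

theorem final_bound (x ε : ℝ) (hε : 0 < ε) (hx : 6 ≤ x) (h : 48 ≤ ε * x) :
    1 / 3 * (x / 2 + 1) ^ 3 + 2 * (x / 4 + 1) ^ 3 ≤
      (7 / 16 + ε) * (x * (x - 1) * (x - 2) / 6) := by
  have a : x ^ 2 / 2 ≤ (x - 1) * (x - 2) := by nlinarith
  have b : ε * x * (x ^ 2 / 2) ≤ ε * x * ((x - 1) * (x - 2)) :=
    mul_le_mul_of_nonneg_left a (by linarith)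
  have c : 48 * (x ^ 2 / 2) ≤ ε * x * (x ^ 2 / 2) :=
    mul_le_mul_of_nonneg_right h (by positivity)
  nlinarith

/-- For every ε > 0 and all large n there is an orgraph Γ on n vertices — an
orientation of a complete balanced bipartite graph — with at most
(7/16 + ε)·C(n,3) edges in FDF(Γ); hence the 7/16 bound is tight without
C⃗₄-freeness. -/
theorem stmt12 :
    ∀ ε : ℝ, ε > 0 → ∃ N : ℕ, ∀ n : ℕ, N ≤ n →
      ∃ E : Fin n → Fin n → Prop,
        IsOrgraph E ∧
        (∃ A : Finset (Fin n), A.card = n / 2 ∧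
          ∀ u v : Fin n, (E u v ∨ E v u) ↔ ((u ∈ A) ↔ (v ∉ A))) ∧
        (fdfCount (Fin n) E : ℝ) ≤ ((7 : ℝ) / 16 + ε) * (n.choose 3 : ℝ) := by
  intro ε hε
  refine ⟨max 6 ⌈48 / ε⌉₊, fun n hn => ⟨cycE n, ?_, ⟨oddSet n, card_oddSet n, ?_⟩, ?_⟩⟩
  · constructor
    · intro v h
      unfold cycE at h
      omega
    · intro v w h h'
      unfold cycE at h h'
      omega
  · intro u v
    simp only [cycE, oddSet, Finset.mem_filter, Finset.mem_univ, true_and]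
    omega
  · have h6 : 6 ≤ n := (le_max_left _ _).trans hn
    have h48 : 48 / ε ≤ (n : ℝ) := Nat.ceil_le.1 ((le_max_right _ _).trans hn)
    rw [choose_three_real n (by omega)]
    refine le_trans (Nat.cast_le.2 (fdfCount_le_cover n)) ((cover_real_bound n).trans ?_)
    refine final_bound n ε hε (by exact_mod_cast h6) ?_
    rw [div_le_iff₀ hε] at h48
    linarith
end
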